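/- arXiv:2405.20056 — 6 statements merged into one kernel-verified Lean document; each statement's English description precedes it below -/
import Mathlib

section
/- Let u and v be two distinct vertices of a connected simple graph G and let x be the Perron vector of the adjacency matrix of G. If N_G(v) \ {u} is a proper subset of N_G(u) \ {v}, then x_u > x_v. -/
open SimpleGraph

section Core

variable {V : Type*}

lemma adjMatrix_isHermitian [Fintype V] [DecidableEq V]
    (G : SimpleGraph V) [DecidableRel G.Adj] :
    (G.adjMatrix ℝ).IsHermitian := by
  ext i j
  simp [Matrix.conjTranspose_apply, SimpleGraph.adj_comm]

/-- The spectral radius (largest adjacency eigenvalue) of a finite simple graph. -/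
noncomputable def SimpleGraph.spectralRadius [Finite V] (G : SimpleGraph V) : ℝ :=
  letI := Fintype.ofFinite V
  letI := Classical.decEq V
  letI := Classical.decRel G.Adj
  ⨆ i, (adjMatrix_isHermitian G).eigenvalues i

/-- `x` is the Perron vector of a connected graph `G`: a positive unit eigenvector
of the adjacency matrix for the eigenvalue `G.spectralRadius`. -/
def SimpleGraph.IsPerronVector [Fintype V] [DecidableEq V] (G : SimpleGraph V)
    [DecidableRel G.Adj] (x : V → ℝ) : Prop :=
  (∀ v, 0 < x v) ∧ (∑ v, x v ^ 2 = 1) ∧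
    (G.adjMatrix ℝ).mulVec x = G.spectralRadius • x

/-- `S` is a vertex cut witnessing the `h`-extra `r`-component condition: removing `S`
leaves at least `r` connected components, each with at least `h+1` vertices. -/
def GoodVertexCut (G : SimpleGraph V) (r h : ℕ) (S : Finset V) : Prop :=
  r ≤ Nat.card (G.induce ((S : Set V)ᶜ)).ConnectedComponent ∧
    ∀ c : (G.induce ((S : Set V)ᶜ)).ConnectedComponent, h + 1 ≤ Nat.card c.supp

/-- `G` has `h`-extra `r`-component connectivity `κ`. -/
def HasExtraConnectivity (G : SimpleGraph V) (r h κ : ℕ) : Prop :=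
  (∃ S : Finset V, S.card = κ ∧ GoodVertexCut G r h S) ∧
    ∀ S : Finset V, GoodVertexCut G r h S → κ ≤ S.card

/-- `F` is an edge cut witnessing the `h`-extra `r`-component condition: removing `F`
leaves at least `r` connected components, each with at least `h+1` vertices. -/
def GoodEdgeCut (G : SimpleGraph V) (r h : ℕ) (F : Finset (Sym2 V)) : Prop :=
  (F : Set (Sym2 V)) ⊆ G.edgeSet ∧
    r ≤ Nat.card (G.deleteEdges (F : Set (Sym2 V))).ConnectedComponent ∧
    ∀ c : (G.deleteEdges (F : Set (Sym2 V))).ConnectedComponent, h + 1 ≤ Nat.card c.supp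

/-- `G` has `h`-extra `r`-component edge-connectivity `lam`. -/
def HasExtraEdgeConnectivity (G : SimpleGraph V) (r h lam : ℕ) : Prop :=
  (∃ F : Finset (Sym2 V), F.card = lam ∧ GoodEdgeCut G r h F) ∧
    ∀ F : Finset (Sym2 V), GoodEdgeCut G r h F → lam ≤ F.card

end Core

/-- A neighbour sum at `u`, with the contribution of a vertex `v` split off. -/
lemma sum_neighborFinset_eq_sum_erase_add {V : Type*} [Fintype V] [DecidableEq V]
    (G : SimpleGraph V) [DecidableRel G.Adj] (x : V → ℝ) (u v : V) :
    ∑ w ∈ G.neighborFinset u, x w =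
      ∑ w ∈ (G.neighborFinset u).erase v, x w + if G.Adj u v then x v else 0 := by
  split_ifs with h
  · rw [Finset.sum_erase_add _ _ ((G.mem_neighborFinset u v).2 h)]
  · rw [Finset.erase_eq_of_notMem (by simpa using h), add_zero]

theorem perronVector_lt_of_neighborSet_ssubset {V : Type*} [Fintype V] [DecidableEq V]
    (G : SimpleGraph V) [DecidableRel G.Adj] (hconn : G.Connected)
    (x : V → ℝ) (hx : G.IsPerronVector x) (u v : V) (huv : u ≠ v)
    (hsub : G.neighborSet v \ {u} ⊂ G.neighborSet u \ {v}) :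
    x v < x u := by
  obtain ⟨hpos, -, heig⟩ := hx
  have hsum (w : V) : ∑ z ∈ G.neighborFinset w, x z = G.spectralRadius * x w := by
    simpa [SimpleGraph.adjMatrix_mulVec_apply] using congrFun heig w
  have hρ : 0 ≤ G.spectralRadius := by
    refine nonneg_of_mul_nonneg_left ?_ (hpos u)
    rw [← hsum u]
    exact Finset.sum_nonneg fun w _ => (hpos w).le
  have hss : (G.neighborFinset v).erase u ⊂ (G.neighborFinset u).erase v := by
    rw [← Finset.coe_ssubset]
    simpa using hsub
  obtain ⟨w, hwu, hwv⟩ := Finset.exists_of_ssubset hss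
  have hlt : ∑ z ∈ (G.neighborFinset v).erase u, x z <
      ∑ z ∈ (G.neighborFinset u).erase v, x z :=
    Finset.sum_lt_sum_of_subset hss.subset hwu hwv (hpos w) fun z _ _ => (hpos z).le
  have hu := sum_neighborFinset_eq_sum_erase_add G x u v
  have hv := sum_neighborFinset_eq_sum_erase_add G x v u
  rw [hsum] at hu hv
  by_contra! hle
  have hmul := mul_le_mul_of_nonneg_left hle hρ
  simp only [G.adj_comm v u] at hv
  split_ifs at hu hv <;> linarith
end

section
/- Let G be a connected simple graph on n vertices with m edges and minimum degree δ ≥ 1. Then ρ(G) ≤ (δ−1)/2 + sqrt(2m − nδ + (δ+1)²/4), with equality if and only if G is a δ-regular graph or a bidegreed graph in which each vertex has degree either δ or n−1. -/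
open SimpleGraph

lemma SimpleGraph.spectralRadius_eq_iSup_eigenvalues {V : Type*} [hV : Fintype V]
    [hV' : DecidableEq V] (G : SimpleGraph V) [hG : DecidableRel G.Adj] :
    G.spectralRadius = ⨆ i, (adjMatrix_isHermitian G).eigenvalues i := by
  have aux : ∀ (i : Fintype V) (d : DecidableEq V) (r : DecidableRel G.Adj),
      (⨆ v, @Matrix.IsHermitian.eigenvalues ℝ _ V i (@adjMatrix ℝ V G r _ _) d
        (@adjMatrix_isHermitian V i d G r) v) =
        ⨆ v, @Matrix.IsHermitian.eigenvalues ℝ _ V hV (@adjMatrix ℝ V G hG _ _) hV'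
          (@adjMatrix_isHermitian V hV hV' G hG) v := by
    intro i d r
    obtain rfl := Subsingleton.elim i hV
    obtain rfl := Subsingleton.elim d hV'
    obtain rfl := Subsingleton.elim r hG
    rfl
  exact aux _ _ _

open Matrix in
lemma Matrix.IsHermitian.posSemidef_iSup_eigenvalues_smul_one_sub {n : Type*} [Fintype n]
    [DecidableEq n] {A : Matrix n n ℝ} (hA : A.IsHermitian) :
    ((⨆ i, hA.eigenvalues i) • (1 : Matrix n n ℝ) - A).PosSemidef := by
  rw [posSemidef_iff_isHermitian_and_spectrum_nonneg]
  refine ⟨(isHermitian_one.smul (IsSelfAdjoint.all _)).sub hA, ?_⟩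
  rw [← Algebra.algebraMap_eq_smul_one, ← spectrum.singleton_sub_eq,
    hA.spectrum_real_eq_range_eigenvalues]
  rintro _ ⟨_, rfl, _, ⟨i, rfl⟩, rfl⟩
  exact sub_nonneg.2 (le_ciSup (Set.finite_range hA.eigenvalues).bddAbove i)

open Matrix in
/-- The Perron–Frobenius theorem for connected graphs. -/
lemma SimpleGraph.Connected.exists_pos_eigenvector {V : Type*} [Fintype V] [DecidableEq V]
    {G : SimpleGraph V} [DecidableRel G.Adj] (hconn : G.Connected) :
    ∃ x : V → ℝ, (∀ v, 0 < x v) ∧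
      ∀ v, ∑ u ∈ G.neighborFinset v, x u = G.spectralRadius * x v := by
  have := hconn.nonempty
  set hA := adjMatrix_isHermitian G
  have hpsd := hA.posSemidef_iSup_eigenvalues_smul_one_sub
  obtain ⟨i, hi⟩ := exists_eq_ciSup_of_finite (f := hA.eigenvalues)
  rw [← G.spectralRadius_eq_iSup_eigenvalues] at hpsd hi
  set ρ := G.spectralRadius
  set y : V → ℝ := ⇑(hA.eigenvectorBasis i) with hy
  have hyA : G.adjMatrix ℝ *ᵥ y = ρ • y := by
    rw [hy, ← hi]; exact hA.mulVec_eigenvectorBasis i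
  have hy0 : y ≠ 0 := by
    intro h
    apply hA.eigenvectorBasis.orthonormal.ne_zero i
    ext v
    exact congrFun h v
  have hle : y ⬝ᵥ G.adjMatrix ℝ *ᵥ y ≤ |y| ⬝ᵥ G.adjMatrix ℝ *ᵥ |y| := by
    simp only [dotProduct, adjMatrix_mulVec_apply, Finset.mul_sum]
    refine Finset.sum_le_sum fun v _ ↦ Finset.sum_le_sum fun u _ ↦ ?_
    simpa [abs_mul] using le_abs_self (y v * y u)
  have habs : |y| ⬝ᵥ |y| = y ⬝ᵥ y := by
    simp [dotProduct]
  have hzero : (ρ • (1 : Matrix V V ℝ) - G.adjMatrix ℝ) *ᵥ |y| = 0 := by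
    rw [← hpsd.dotProduct_mulVec_zero_iff]
    refine le_antisymm ?_ (hpsd.dotProduct_mulVec_nonneg _)
    rw [hyA, dotProduct_smul, smul_eq_mul] at hle
    simp only [star_trivial, Matrix.sub_mulVec, Matrix.smul_mulVec, Matrix.one_mulVec,
      dotProduct_sub, dotProduct_smul, smul_eq_mul, habs]
    linarith
  have hev : ∀ v, ∑ u ∈ G.neighborFinset v, |y| u = ρ * |y| v := by
    intro v
    have := congrFun hzero v
    simp only [Matrix.sub_mulVec, Matrix.smul_mulVec, Matrix.one_mulVec, Pi.sub_apply,
      adjMatrix_mulVec_apply, Pi.smul_apply, smul_eq_mul, Pi.zero_apply] at this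
    linarith
  have hprop : ∀ v u, G.Adj v u → y v = 0 → y u = 0 := by
    intro v u hvu hv
    have h := hev v
    simp only [Pi.abs_apply, hv, abs_zero, mul_zero] at h
    rw [Finset.sum_eq_zero_iff_of_nonneg (fun _ _ ↦ abs_nonneg _)] at h
    simpa using h u (by simpa using hvu)
  refine ⟨|y|, fun v ↦ abs_pos.2 fun hv ↦ hy0 ?_, hev⟩
  ext u
  obtain ⟨p⟩ := hconn.preconnected v u
  induction p with
  | nil => exact hv
  | cons h _ ih => exact ih (hprop _ _ h hv)

lemma SimpleGraph.sum_neighborFinset_add_sum_compl {V M : Type*} [Fintype V] [DecidableEq V]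
    [AddCommMonoid M] (G : SimpleGraph V) [DecidableRel G.Adj] (g : V → M) (v : V) :
    ∑ u ∈ G.neighborFinset v, g u + g v + ∑ u ∈ Gᶜ.neighborFinset v, g u = ∑ u, g u := by
  rw [neighborFinset_compl, ← Finset.sum_add_sum_compl (G.neighborFinset v) g, add_assoc,
    Finset.sdiff_singleton_eq_erase, Finset.add_sum_erase _ _ (by simp)]

lemma SimpleGraph.sum_mul_sum_neighborFinset {V R : Type*} [Fintype V] [CommRing R]
    (G : SimpleGraph V) [DecidableRel G.Adj] {x : V → R} {r : R}
    (hx : ∀ v, ∑ u ∈ G.neighborFinset v, x u = r * x v) (f : V → R) :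
    ∑ v, x v * ∑ u ∈ G.neighborFinset v, f u = r * ∑ v, x v * f v := by
  simp_rw [Finset.mul_sum]
  rw [Finset.sum_comm' (t' := Finset.univ) (s' := fun u ↦ G.neighborFinset u)
    (by simp [adj_comm])]
  refine Finset.sum_congr rfl fun u _ ↦ ?_
  rw [← Finset.sum_mul, hx, mul_assoc]

/-- The gap in Hong's bound, weighted by an eigenvector, is the excess degree of non-neighbours. -/
lemma SimpleGraph.sum_mul_excess_compl {V : Type*} [Fintype V] [DecidableEq V]
    (G : SimpleGraph V) [DecidableRel G.Adj] {x : V → ℝ} {r : ℝ}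
    (hx : ∀ v, ∑ u ∈ G.neighborFinset v, x u = r * x v) (d : ℝ) :
    ∑ v, x v * ∑ u ∈ Gᶜ.neighborFinset v, ((G.degree u : ℝ) - d) =
      (2 * (G.edgeFinset.card : ℝ) - Fintype.card V * d + d - (r ^ 2 - (d - 1) * r)) *
        ∑ v, x v := by
  have hdeg : ∑ v, (G.degree v : ℝ) = 2 * (G.edgeFinset.card : ℝ) := by
    exact_mod_cast G.sum_degrees_eq_twice_card_edges
  have h₁ : ∑ v, x v * (G.degree v : ℝ) = r * ∑ v, x v := by
    simpa using G.sum_mul_sum_neighborFinset hx 1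
  have h₂ := G.sum_mul_sum_neighborFinset hx (fun u ↦ (G.degree u : ℝ))
  rw [h₁] at h₂
  have h₃ : ∀ v, ∑ u ∈ Gᶜ.neighborFinset v, ((G.degree u : ℝ) - d) =
      (2 * (G.edgeFinset.card : ℝ) - Fintype.card V * d + d) -
        (∑ u ∈ G.neighborFinset v, (G.degree u : ℝ)) + (d - 1) * G.degree v := by
    intro v
    have h := G.sum_neighborFinset_add_sum_compl (fun u ↦ (G.degree u : ℝ) - d) v
    rw [Finset.sum_sub_distrib, Finset.sum_sub_distrib (s := Finset.univ), hdeg] at h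
    simp only [Finset.sum_const, card_neighborFinset_eq_degree, nsmul_eq_mul,
      Finset.card_univ] at h
    linear_combination h
  calc _ = ∑ v, ((2 * (G.edgeFinset.card : ℝ) - Fintype.card V * d + d) * x v -
        x v * (∑ u ∈ G.neighborFinset v, (G.degree u : ℝ)) +
        (d - 1) * (x v * G.degree v)) := by
        refine Finset.sum_congr rfl fun v _ ↦ ?_
        rw [h₃]; ring
    _ = _ := by
      rw [Finset.sum_add_distrib, Finset.sum_sub_distrib, ← Finset.mul_sum, ← Finset.mul_sum,
        h₁, h₂]
      ring

lemma SimpleGraph.sum_excess_compl_eq_zero_iff {V : Type*} [Fintype V] [DecidableEq V]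
    (G : SimpleGraph V) [DecidableRel G.Adj] :
    (∀ v, ∑ u ∈ Gᶜ.neighborFinset v, ((G.degree u : ℝ) - G.minDegree) = 0) ↔
      ∀ u, G.degree u = G.minDegree ∨ G.degree u = Fintype.card V - 1 := by
  have hnn : ∀ u, (0 : ℝ) ≤ G.degree u - G.minDegree := fun u ↦
    sub_nonneg.2 (by exact_mod_cast G.minDegree_le_degree u)
  have hfull : ∀ u, G.degree u = Fintype.card V - 1 ↔ ∀ v, ¬ Gᶜ.Adj u v := by
    intro u
    have h₁ := G.degree_compl (v := u)
    have h₂ := G.degree_lt_card_verts u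
    have h₃ : Gᶜ.degree u = 0 ↔ ∀ v, ¬ Gᶜ.Adj u v := by
      rw [← card_neighborFinset_eq_degree, Finset.card_eq_zero, Finset.eq_empty_iff_forall_notMem]
      simp only [mem_neighborFinset]
    rw [← h₃]
    omega
  simp only [Finset.sum_eq_zero_iff_of_nonneg (fun u _ ↦ hnn u), mem_neighborFinset, hfull,
    sub_eq_zero, Nat.cast_inj]
  constructor
  · intro h u
    by_contra! hu
    obtain ⟨hu, v, hv⟩ := hu
    exact hu (h v u hv.symm)
  · intro h v u hvu
    exact (h u).resolve_right fun h' ↦ h' v hvu.symm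

theorem spectralRadius_le_hong_bound {V : Type*} [Fintype V] [DecidableEq V]
    (G : SimpleGraph V) [DecidableRel G.Adj] (hconn : G.Connected) (hδ : 1 ≤ G.minDegree) :
    G.spectralRadius ≤ ((G.minDegree : ℝ) - 1) / 2 +
        Real.sqrt (2 * (G.edgeFinset.card : ℝ) - (Fintype.card V : ℝ) * (G.minDegree : ℝ) +
          ((G.minDegree : ℝ) + 1) ^ 2 / 4) ∧
      (G.spectralRadius = ((G.minDegree : ℝ) - 1) / 2 +
          Real.sqrt (2 * (G.edgeFinset.card : ℝ) - (Fintype.card V : ℝ) * (G.minDegree : ℝ) +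
            ((G.minDegree : ℝ) + 1) ^ 2 / 4) ↔
        (G.IsRegularOfDegree G.minDegree ∨
          ((∀ v, G.degree v = G.minDegree ∨ G.degree v = Fintype.card V - 1) ∧
            (∃ v, G.degree v = G.minDegree) ∧ (∃ v, G.degree v = Fintype.card V - 1)))) := by
  obtain ⟨x, hpos, hx⟩ := hconn.exists_pos_eigenvector
  have := hconn.nonempty
  have hsum : 0 < ∑ v, x v := Finset.sum_pos (fun v _ ↦ hpos v) Finset.univ_nonempty
  have hmin : ∀ v, (G.minDegree : ℝ) ≤ G.degree v := fun v ↦ by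
    exact_mod_cast G.minDegree_le_degree v
  have hexc : ∀ v, 0 ≤ ∑ u ∈ Gᶜ.neighborFinset v, ((G.degree u : ℝ) - G.minDegree) :=
    fun v ↦ Finset.sum_nonneg fun u _ ↦ sub_nonneg.2 (hmin u)
  have hkey := G.sum_mul_excess_compl hx G.minDegree
  have hrhs : (G.IsRegularOfDegree G.minDegree ∨
      ((∀ v, G.degree v = G.minDegree ∨ G.degree v = Fintype.card V - 1) ∧
        (∃ v, G.degree v = G.minDegree) ∧ (∃ v, G.degree v = Fintype.card V - 1))) ↔
      ∀ v, G.degree v = G.minDegree ∨ G.degree v = Fintype.card V - 1 := by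
    obtain ⟨w, hw⟩ := G.exists_minimal_degree_vertex
    constructor
    · rintro (h | h)
      · exact fun v ↦ Or.inl (h v)
      · exact h.1
    · intro h
      by_cases hv : ∃ v, G.degree v = Fintype.card V - 1
      · exact Or.inr ⟨h, ⟨w, hw.symm⟩, hv⟩
      · exact Or.inl fun v ↦ (h v).resolve_right fun h' ↦ hv ⟨v, h'⟩
  have hδρ : (G.minDegree : ℝ) ≤ G.spectralRadius := by
    have h : ∑ v, x v * (G.degree v : ℝ) = G.spectralRadius * ∑ v, x v := by
      simpa using G.sum_mul_sum_neighborFinset hx 1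
    refine le_of_mul_le_mul_right ?_ hsum
    rw [← h, mul_comm, Finset.sum_mul]
    exact Finset.sum_le_sum fun v _ ↦ mul_le_mul_of_nonneg_left (hmin v) (hpos v).le
  rw [hrhs, ← G.sum_excess_compl_eq_zero_iff]
  have hgap : (∀ v, ∑ u ∈ Gᶜ.neighborFinset v, ((G.degree u : ℝ) - G.minDegree) = 0) ↔
      ∑ v, x v * ∑ u ∈ Gᶜ.neighborFinset v, ((G.degree u : ℝ) - G.minDegree) = 0 := by
    rw [Finset.sum_eq_zero_iff_of_nonneg fun v _ ↦ mul_nonneg (hpos v).le (hexc v)]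
    simp only [Finset.mem_univ, true_imp_iff, mul_eq_zero, (hpos _).ne', false_or]
  have hnonneg : 0 ≤ ∑ v, x v * ∑ u ∈ Gᶜ.neighborFinset v, ((G.degree u : ℝ) - G.minDegree) :=
    Finset.sum_nonneg fun v _ ↦ mul_nonneg (hpos v).le (hexc v)
  rw [hkey] at hnonneg
  rw [hgap, hkey, mul_eq_zero, or_iff_left hsum.ne']
  have hquad := nonneg_of_mul_nonneg_left hnonneg hsum
  have hcenter : 0 ≤ G.spectralRadius - ((G.minDegree : ℝ) - 1) / 2 := by
    have : (1 : ℝ) ≤ G.minDegree := by exact_mod_cast hδ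
    linarith
  set ρ := G.spectralRadius
  set d : ℝ := (G.minDegree : ℝ)
  constructor
  · rw [← sub_le_iff_le_add']
    apply Real.le_sqrt_of_sq_le
    linarith
  · rw [← sub_eq_iff_eq_add', eq_comm, Real.sqrt_eq_iff_mul_self_eq (by nlinarith) hcenter]
    constructor <;> intro h <;> linarith
end

section
/- Let r, δ, n, h, λ be positive integers with r ≥ 2, n ≥ (λ+1)(h+1)², λ ≥ r−1, and h ≥ δ. Let G be any graph in the family K^{λ}_{n,δ}. Then n − (r−1)(h+1) − 1 < ρ(G) < n − (r−1)(h+1). -/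
open SimpleGraph

/-- Vertex type for the graph `B^{λ,δ}_n`: the parts are `K_{n-(r-1)(h+1)-λ+r-2}`,
`K_{λ-r+2}`, the `r-2` copies of `K_{h+1}`, `K_δ ∨ K_{h-δ}` (a copy of `K_h` whose first
`δ` vertices form the distinguished `K_δ`), and `K_1`. -/
abbrev BVert (n r h lam : ℕ) : Type :=
  Fin (n - (r - 1) * (h + 1) - lam + r - 2) ⊕
    (Fin (lam - r + 2) ⊕ ((Fin (r - 2) × Fin (h + 1)) ⊕ (Fin h ⊕ Unit)))

/-- The graph `B^{λ,δ}_n`, obtained from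
`(K_{n-(r-1)(h+1)-λ+r-2} ∨ K_{λ-r+2}) ∪ (r-2)K_{h+1} ∪ (K_δ ∨ K_{h-δ}) ∪ K_1` by adding
`δ` edges between the vertex of `K_1` and all vertices of `K_δ`, adding `λ-r+2` edges
between a vertex of one copy of `K_{h+1}` and all vertices of `K_{λ-r+2}`, and adding
`r-2` edges joining a vertex of `K_{λ-r+2}` to one vertex in each remaining copy of
`K_{h+1}` and to one vertex of `K_δ`. -/
def BGraph (n r h lam δ : ℕ) : SimpleGraph (BVert n r h lam) :=
  SimpleGraph.fromRel fun a b =>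
    match a, b with
    | .inl _, .inl _ => True
    | .inl _, .inr (.inl _) => True
    | .inr (.inl _), .inr (.inl _) => True
    | .inr (.inl b), .inr (.inr (.inl p)) =>
        ((p.1 : ℕ) = 0 ∧ (p.2 : ℕ) = 0) ∨ ((b : ℕ) = 0 ∧ (p.1 : ℕ) ≠ 0 ∧ (p.2 : ℕ) = 0)
    | .inr (.inl b), .inr (.inr (.inr (.inl k))) => (b : ℕ) = 0 ∧ (k : ℕ) = 0
    | .inr (.inr (.inl p)), .inr (.inr (.inl q)) => p.1 = q.1
    | .inr (.inr (.inr (.inl _))), .inr (.inr (.inr (.inl _))) => True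
    | .inr (.inr (.inr (.inl k))), .inr (.inr (.inr (.inr _))) => (k : ℕ) < δ
    | _, _ => False

/-- Vertex type for the graphs in the family `𝒦^{λ}_{n,δ}`: the parts are
`K_{n-(r-1)(h+1)}`, the `r-2` copies of `K_{h+1}`, `K_h`, and `K_1`. -/
abbrev KVert (n r h : ℕ) : Type :=
  Fin (n - (r - 1) * (h + 1)) ⊕ ((Fin (r - 2) × Fin (h + 1)) ⊕ (Fin h ⊕ Unit))

/-- Membership in the family `𝒦^{λ}_{n,δ}`: graphs with `h`-extra `r`-component
edge-connectivity `lam` and minimum degree `δ` obtained from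
`K_{n-(r-1)(h+1)} ∪ (r-2)K_{h+1} ∪ K_h ∪ K_1` by adding `t` edges (`1 ≤ t ≤ δ`) between
the vertex of `K_1` and `K_h`, `r-1` edges joining a vertex of `K_{n-(r-1)(h+1)}` to one
vertex in each copy of `K_{h+1}` and in `K_h`, and `lam - r + 1 - δ + t` further edges
between `K_{n-(r-1)(h+1)}` and `(r-2)K_{h+1} ∪ K_h ∪ K_1` (so that the number of edges
leaving `K_{n-(r-1)(h+1)}` is `lam - δ + t`). -/
def InKFamily (n r h lam δ : ℕ) (G : SimpleGraph (KVert n r h)) : Prop :=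
  -- each of the parts induces a complete graph
  (∀ a b : Fin (n - (r - 1) * (h + 1)), a ≠ b → G.Adj (Sum.inl a) (Sum.inl b)) ∧
  (∀ p q : Fin (r - 2) × Fin (h + 1), p.1 = q.1 → p ≠ q →
    G.Adj (Sum.inr (Sum.inl p)) (Sum.inr (Sum.inl q))) ∧
  (∀ a b : Fin h, a ≠ b → G.Adj (Sum.inr (Sum.inr (Sum.inl a))) (Sum.inr (Sum.inr (Sum.inl b)))) ∧
  -- there are no edges between distinct copies of `K_{h+1}`, nor from a copy of
  -- `K_{h+1}` to `K_h` or to `K_1`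
  (∀ p q : Fin (r - 2) × Fin (h + 1), p.1 ≠ q.1 →
    ¬ G.Adj (Sum.inr (Sum.inl p)) (Sum.inr (Sum.inl q))) ∧
  (∀ (p : Fin (r - 2) × Fin (h + 1)) (a : Fin h),
    ¬ G.Adj (Sum.inr (Sum.inl p)) (Sum.inr (Sum.inr (Sum.inl a)))) ∧
  (∀ p : Fin (r - 2) × Fin (h + 1),
    ¬ G.Adj (Sum.inr (Sum.inl p)) (Sum.inr (Sum.inr (Sum.inr ())))) ∧
  -- there are `t` edges between `K_1` and `K_h` for some `1 ≤ t ≤ δ`, and the total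
  -- number of edges leaving the big clique is `(r-1) + (lam - r + 1 - δ + t) = lam - δ + t`
  (∃ t : ℕ, 1 ≤ t ∧ t ≤ δ ∧
    Nat.card {k : Fin h //
      G.Adj (Sum.inr (Sum.inr (Sum.inl k))) (Sum.inr (Sum.inr (Sum.inr ())))} = t ∧
    Nat.card {p : Fin (n - (r - 1) * (h + 1)) × ((Fin (r - 2) × Fin (h + 1)) ⊕ (Fin h ⊕ Unit)) //
      G.Adj (Sum.inl p.1) (Sum.inr p.2)} + δ = lam + t) ∧
  -- a vertex of the big clique is joined to each copy of `K_{h+1}` and to `K_h`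
  (∃ v0 : Fin (n - (r - 1) * (h + 1)),
    (∀ i : Fin (r - 2), ∃ a : Fin (h + 1), G.Adj (Sum.inl v0) (Sum.inr (Sum.inl (i, a)))) ∧
    (∃ k : Fin h, G.Adj (Sum.inl v0) (Sum.inr (Sum.inr (Sum.inl k))))) ∧
  HasExtraEdgeConnectivity G r h lam ∧
  -- minimum degree is `δ`
  (∀ v, δ ≤ Nat.card (G.neighborSet v)) ∧ (∃ v, Nat.card (G.neighborSet v) = δ)

namespace SimpleGraph

variable {V : Type*} [Fintype V] (G : SimpleGraph V) [DecidableRel G.Adj]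

lemma adjMatrix_mulVec_apply_eq_sum_ite (x : V → ℝ) (v : V) :
    ((G.adjMatrix ℝ).mulVec x) v = ∑ u, if G.Adj v u then x u else 0 := by
  simp [Matrix.mulVec, dotProduct, adjMatrix_apply]

variable [DecidableEq V]

lemma spectralRadius_eq_iSup_eigenvalues_s9 :
    G.spectralRadius = ⨆ i, (adjMatrix_isHermitian G).eigenvalues i := by
  unfold spectralRadius
  convert rfl

/-- The spectral radius bounds every Rayleigh quotient. -/
lemma dotProduct_adjMatrix_mulVec_le_spectralRadius_mul (x : V → ℝ) :
    x ⬝ᵥ (G.adjMatrix ℝ).mulVec x ≤ G.spectralRadius * (x ⬝ᵥ x) := by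
  have hA := adjMatrix_isHermitian G
  have hpos : (algebraMap ℝ (Matrix V V ℝ) G.spectralRadius - G.adjMatrix ℝ).PosSemidef := by
    rw [Matrix.posSemidef_iff_isHermitian_and_spectrum_nonneg]
    refine ⟨Matrix.IsHermitian.sub ?_ hA, ?_⟩
    · ext i j
      simp [Matrix.algebraMap_matrix_apply, eq_comm]
    · rw [← spectrum.singleton_sub_eq, hA.spectrum_real_eq_range_eigenvalues]
      rintro _ ⟨_, rfl, _, ⟨i, rfl⟩, rfl⟩
      rw [spectralRadius_eq_iSup_eigenvalues_s9]
      exact sub_nonneg.2 (le_ciSup (Set.finite_range hA.eigenvalues).bddAbove i)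
  have h := hpos.dotProduct_mulVec_nonneg x
  rw [Matrix.sub_mulVec, dotProduct_sub, Algebra.algebraMap_eq_smul_one, Matrix.smul_mulVec,
    Matrix.one_mulVec, dotProduct_smul, smul_eq_mul, star_trivial] at h
  exact sub_nonneg.1 h

/-- A strict Collatz–Wielandt bound: a positive vector `y` with `A y < c y` entrywise
forces the spectral radius to be less than `c`. -/
lemma spectralRadius_lt_of_adjMatrix_mulVec_lt [Nonempty V] {c : ℝ} {y : V → ℝ}
    (hy : ∀ v, 0 < y v) (h : ∀ v, ((G.adjMatrix ℝ).mulVec y) v < c * y v) :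
    G.spectralRadius < c := by
  have hA := adjMatrix_isHermitian G
  obtain ⟨i, hi⟩ := exists_eq_ciSup_of_finite (f := hA.eigenvalues)
  rw [spectralRadius_eq_iSup_eigenvalues_s9, ← hi]
  set μ := hA.eigenvalues i
  obtain ⟨x, hx0, hx⟩ : ∃ x : V → ℝ, x ≠ 0 ∧ (G.adjMatrix ℝ).mulVec x = μ • x := by
    refine ⟨_, fun h0 => ?_, hA.mulVec_eigenvectorBasis i⟩
    exact hA.eigenvectorBasis.orthonormal.ne_zero i (by ext v; exact congrFun h0 v)
  obtain ⟨v, hv⟩ := Finite.exists_max fun v => |x v| / y v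
  set M := |x v| / y v
  have hle : ∀ u, |x u| ≤ M * y u := fun u => (div_le_iff₀ (hy u)).1 (hv u)
  have hMv : |x v| = M * y v := (div_mul_cancel₀ _ (hy v).ne').symm
  have hM : 0 < M := by
    obtain ⟨w, hw⟩ := Function.ne_iff.1 hx0
    exact (div_pos (abs_pos.2 hw) (hy w)).trans_le (hv w)
  have key : μ * |x v| ≤ M * ((G.adjMatrix ℝ).mulVec y) v := by
    calc μ * |x v| ≤ |μ * x v| := by
          rw [abs_mul]; exact mul_le_mul_of_nonneg_right (le_abs_self _) (abs_nonneg _)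
      _ = |((G.adjMatrix ℝ).mulVec x) v| := by rw [hx]; rfl
      _ ≤ M * ((G.adjMatrix ℝ).mulVec y) v := by
          rw [adjMatrix_mulVec_apply_eq_sum_ite, adjMatrix_mulVec_apply_eq_sum_ite,
            Finset.mul_sum]
          refine (Finset.abs_sum_le_sum_abs _ _).trans (Finset.sum_le_sum fun u _ => ?_)
          split_ifs
          · exact hle u
          · simp
  have h1 : μ * (M * y v) < M * (c * y v) := by
    rw [← hMv]
    exact key.trans_lt (mul_lt_mul_of_pos_left (h v) hM)
  refine lt_of_mul_lt_mul_right ?_ (mul_pos hM (hy v)).le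
  linarith

end SimpleGraph

section SumType

variable {A B : Type*} [Fintype A] [Fintype B] [DecidableEq A] [DecidableEq B]
  (G : SimpleGraph (A ⊕ B)) [DecidableRel G.Adj]

/-- A graph containing a clique on `A` together with an edge leaving `A` has spectral radius
greater than `|A| - 1`. -/
lemma card_sub_one_lt_spectralRadius (hA : ∀ a a' : A, a ≠ a' → G.Adj (Sum.inl a) (Sum.inl a'))
    {a₀ : A} {b₀ : B} (h : G.Adj (Sum.inl a₀) (Sum.inr b₀)) :
    (Fintype.card A : ℝ) - 1 < G.spectralRadius := by
  set m : ℝ := (Fintype.card A : ℝ) with hm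
  have hm1 : 1 ≤ m := by
    rw [hm]; exact_mod_cast Fintype.card_pos_iff.2 ⟨a₀⟩
  have hm0 : 0 < m := by linarith
  set x : A ⊕ B → ℝ := Sum.elim (fun _ => 1) (fun b => if b = b₀ then 1 / m else 0) with hxdef
  set d : ℝ := ∑ a : A, if G.Adj (Sum.inl a) (Sum.inr b₀) then 1 else 0 with hd
  have hd1 : 1 ≤ d := by
    have := Finset.single_le_sum (f := fun a : A =>
      if G.Adj (Sum.inl a) (Sum.inr b₀) then (1 : ℝ) else 0)
      (fun a _ => by positivity) (Finset.mem_univ a₀)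
    rwa [if_pos h] at this
  have hxx : x ⬝ᵥ x = m + 1 / m ^ 2 := by
    simp [dotProduct, hxdef, Fintype.sum_sum_type, hm, sq]
  have hl (a : A) : ((G.adjMatrix ℝ).mulVec x) (Sum.inl a) =
      (m - 1) + (if G.Adj (Sum.inl a) (Sum.inr b₀) then 1 else 0) * (1 / m) := by
    rw [adjMatrix_mulVec_apply_eq_sum_ite, Fintype.sum_sum_type]
    congr 1
    · have (a' : A) : (if G.Adj (Sum.inl a) (Sum.inl a') then x (Sum.inl a') else 0) =
          1 - if a = a' then 1 else 0 := by
        by_cases e : a = a'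
        · subst e; simp
        · simp [e, hA a a' e, hxdef]
      simp [this, hm]
    · rw [Finset.sum_eq_single b₀]
      · simp [hxdef]
      · intro b _ hb
        simp [hxdef, hb]
      · simp
  have hr : d ≤ ((G.adjMatrix ℝ).mulVec x) (Sum.inr b₀) := by
    rw [adjMatrix_mulVec_apply_eq_sum_ite, Fintype.sum_sum_type]
    refine le_add_of_le_of_nonneg (le_of_eq ?_) (Finset.sum_nonneg fun b _ => ?_)
    · simp [hd, hxdef, G.adj_comm (Sum.inr b₀)]
    · simp only [hxdef, Sum.elim_inr]
      positivity
  have hq : m * (m - 1) + 2 * d / m ≤ x ⬝ᵥ (G.adjMatrix ℝ).mulVec x := by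
    have : x ⬝ᵥ (G.adjMatrix ℝ).mulVec x = m * (m - 1) + d * (1 / m) +
        1 / m * ((G.adjMatrix ℝ).mulVec x) (Sum.inr b₀) := by
      rw [dotProduct, Fintype.sum_sum_type]
      simp only [hl]
      congr 1
      · simp only [hxdef, Sum.elim_inl, one_mul, Finset.sum_add_distrib, ← Finset.sum_mul, hd]
        simp [hm, mul_sub]
      · rw [Finset.sum_eq_single b₀]
        · simp [hxdef]
        · intro b _ hb
          simp [hxdef, hb]
        · simp
    rw [this]
    have := mul_le_mul_of_nonneg_left hr (one_div_pos.2 hm0).le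
    have e : 2 * d / m = d * (1 / m) + 1 / m * d := by ring
    linarith
  have hR := G.dotProduct_adjMatrix_mulVec_le_spectralRadius_mul x
  rw [hxx] at hR
  refine lt_of_mul_lt_mul_right (lt_of_lt_of_le ?_ (hq.trans hR)) (by positivity)
  have e : (m - 1) * (m + 1 / m ^ 2) = m * (m - 1) + (m - 1) / m ^ 2 := by ring
  have e' : 2 * d / m = 2 * d * m / m ^ 2 := by field_simp
  rw [e, e']
  gcongr
  nlinarith

/-- If `G` has `e` edges between `A` and `B`, every vertex of `B` has at most `k` neighbours
in `B`, and `|A|` exceeds both `2 * e` and `e + k`, then the spectral radius is less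
than `|A|`. -/
lemma spectralRadius_lt_card {e k : ℕ}
    (he : Fintype.card {p : A × B // G.Adj (Sum.inl p.1) (Sum.inr p.2)} = e)
    (hk : ∀ b : B, (Finset.univ.filter fun b' => G.Adj (Sum.inr b) (Sum.inr b')).card ≤ k)
    (h2e : 2 * e < Fintype.card A) (hek : e + k < Fintype.card A) :
    G.spectralRadius < Fintype.card A := by
  have hcard : 0 < Fintype.card A := by omega
  set m : ℝ := (Fintype.card A : ℝ) with hm
  have hm0 : 0 < m := by rw [hm]; exact_mod_cast hcard
  have h2e' : 2 * (e : ℝ) < m := by rw [hm]; exact_mod_cast h2e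
  have hek' : (e : ℝ) + k < m := by rw [hm]; exact_mod_cast hek
  have : Nonempty A := Fintype.card_pos_iff.1 hcard
  set d : B → ℝ := fun b => ∑ a : A, if G.Adj (Sum.inl a) (Sum.inr b) then 1 else 0 with hd
  have hd0 (b : B) : 0 ≤ d b := Finset.sum_nonneg fun a _ => by positivity
  have hde : ∑ b, d b = e := by
    rw [← he, Fintype.card_subtype, Finset.card_filter, Fintype.sum_prod_type_right]
    push_cast
    rfl
  refine G.spectralRadius_lt_of_adjMatrix_mulVec_lt
    (y := Sum.elim (fun _ => 1) fun b => (d b + 1) / m) ?_ ?_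
  · rintro (a | b)
    · simp
    · have := hd0 b
      simp only [Sum.elim_inr]
      positivity
  · rintro (a | b)
    · rw [adjMatrix_mulVec_apply_eq_sum_ite, Fintype.sum_sum_type]
      simp only [Sum.elim_inl, Sum.elim_inr, mul_one]
      have h1 : (∑ a' : A, if G.Adj (Sum.inl a) (Sum.inl a') then (1 : ℝ) else 0) ≤ m - 1 := by
        calc _ ≤ ∑ a' : A, ((1 : ℝ) - if a = a' then 1 else 0) := by
              refine Finset.sum_le_sum fun a' _ => ?_
              by_cases e : a = a'
              · subst e; simp
              · simp only [e, if_false, sub_zero]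
                split_ifs <;> norm_num
          _ = m - 1 := by simp [hm]
      have h2 : (∑ b : B, if G.Adj (Sum.inl a) (Sum.inr b) then (d b + 1) / m else 0) ≤
          (2 * e) / m := by
        calc _ ≤ ∑ b : B, (2 * d b) / m := by
              refine Finset.sum_le_sum fun b _ => ?_
              split_ifs with hab
              · have : 1 ≤ d b := by
                  have := Finset.single_le_sum (f := fun a : A =>
                    if G.Adj (Sum.inl a) (Sum.inr b) then (1 : ℝ) else 0)
                    (fun a _ => by positivity) (Finset.mem_univ a)
                  rwa [if_pos hab] at this
                gcongr
                linarith
              · have := hd0 b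
                positivity
          _ = (2 * e) / m := by rw [← Finset.sum_div, ← Finset.mul_sum, hde]
      have h3 : (2 * e) / m < 1 := (div_lt_one hm0).2 h2e'
      linarith
    · rw [adjMatrix_mulVec_apply_eq_sum_ite, Fintype.sum_sum_type]
      simp only [Sum.elim_inl, Sum.elim_inr]
      rw [mul_div_cancel₀ _ hm0.ne']
      have h1 : (∑ a : A, if G.Adj (Sum.inr b) (Sum.inl a) then (1 : ℝ) else 0) = d b := by
        simp only [hd, G.adj_comm (Sum.inr b)]
      have h2 : (∑ b' : B, if G.Adj (Sum.inr b) (Sum.inr b') then (d b' + 1) / m else 0) ≤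
          (e + k) / m := by
        calc _ ≤ ∑ b' : B, (d b' + if G.Adj (Sum.inr b) (Sum.inr b') then 1 else 0) / m := by
              refine Finset.sum_le_sum fun b' _ => ?_
              have := hd0 b'
              split_ifs
              · rfl
              · positivity
          _ ≤ (e + k) / m := by
              rw [← Finset.sum_div, Finset.sum_add_distrib, hde, Finset.sum_boole]
              have : ((Finset.univ.filter fun b' =>
                G.Adj (Sum.inr b) (Sum.inr b')).card : ℝ) ≤ k := by exact_mod_cast hk b
              gcongr
      have h3 : (e + k : ℝ) / m < 1 := (div_lt_one hm0).2 hek'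
      linarith

end SumType

/-- A vertex of a graph in the family has at most `h + 1` neighbours outside the big clique. -/
lemma InKFamily.card_outer_neighbors_le {n r h lam δ : ℕ} {G : SimpleGraph (KVert n r h)}
    [DecidableRel G.Adj] (hG : InKFamily n r h lam δ G)
    (b : (Fin (r - 2) × Fin (h + 1)) ⊕ (Fin h ⊕ Unit)) :
    (Finset.univ.filter fun b' => G.Adj (Sum.inr b) (Sum.inr b')).card ≤ h + 1 := by
  obtain ⟨-, -, -, hne, hpk, hpu, -⟩ := hG
  rcases b with p | q
  · calc _ ≤ (Finset.univ.image fun j : Fin (h + 1) =>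
          (Sum.inl (p.1, j) : (Fin (r - 2) × Fin (h + 1)) ⊕ (Fin h ⊕ Unit))).card := by
          refine Finset.card_le_card fun b' hb' => ?_
          simp only [Finset.mem_filter, Finset.mem_univ, true_and, Finset.mem_image] at hb' ⊢
          rcases b' with p' | a | u
          · exact ⟨p'.2, by rw [not_imp_not.1 (hne p p') hb']⟩
          · exact absurd hb' (hpk p a)
          · exact absurd hb' (hpu p)
      _ ≤ h + 1 := Finset.card_image_le.trans (by simp)
  · calc _ ≤ (Finset.univ.image fun q' : Fin h ⊕ Unit =>
          (Sum.inr q' : (Fin (r - 2) × Fin (h + 1)) ⊕ (Fin h ⊕ Unit))).card := by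
          refine Finset.card_le_card fun b' hb' => ?_
          simp only [Finset.mem_filter, Finset.mem_univ, true_and, Finset.mem_image] at hb' ⊢
          rcases b' with p' | q'
          · rcases q with a | u
            · exact absurd hb'.symm (hpk p' a)
            · exact absurd hb'.symm (hpu p')
          · exact ⟨q', rfl⟩
      _ ≤ h + 1 := Finset.card_image_le.trans (by simp)

theorem spectralRadius_bounds_of_mem_KFamily (n r h lam δ : ℕ)
    (hr : 2 ≤ r) (hh : 1 ≤ h) (hδ : 1 ≤ δ) (hlam1 : 1 ≤ lam) (hn : 1 ≤ n)
    (hδh : δ ≤ h) (hlam : r - 1 ≤ lam) (hnbig : (lam + 1) * (h + 1) ^ 2 ≤ n)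
    (G : SimpleGraph (KVert n r h)) (hG : InKFamily n r h lam δ G) :
    (n : ℝ) - ((r : ℝ) - 1) * ((h : ℝ) + 1) - 1 < G.spectralRadius ∧
      G.spectralRadius < (n : ℝ) - ((r : ℝ) - 1) * ((h : ℝ) + 1) := by
  classical
  have hr1 : (r - 1) * (h + 1) ≤ lam * (h + 1) := Nat.mul_le_mul_right _ hlam
  have hbig : lam * (h + 1) + 2 * lam + h + 2 ≤ n := by
    have h1 : 2 * (h + 1) ≤ (h + 1) ^ 2 := by nlinarith
    have h2 : (lam + 1) * (2 * (h + 1)) ≤ (lam + 1) * (h + 1) ^ 2 := Nat.mul_le_mul_left _ h1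
    have h3 : lam * 1 ≤ lam * h := Nat.mul_le_mul_left _ hh
    linarith
  have hm : ((n - (r - 1) * (h + 1) : ℕ) : ℝ) = n - ((r : ℝ) - 1) * ((h : ℝ) + 1) := by
    rw [Nat.cast_sub (by omega), Nat.cast_mul, Nat.cast_sub (by omega)]
    push_cast
    ring
  have hk := hG.card_outer_neighbors_le
  obtain ⟨hclique, -, -, -, -, -, ⟨t, -, htδ, -, hcross⟩, ⟨v₀, -, k₀, hk₀⟩, -⟩ := hG
  rw [Nat.card_eq_fintype_card] at hcross
  rw [← hm]
  constructor
  · simpa using card_sub_one_lt_spectralRadius G hclique hk₀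
  · have := spectralRadius_lt_card G rfl hk (by rw [Fintype.card_fin]; omega)
      (by rw [Fintype.card_fin]; omega)
    simpa using this
end

section
/- Let G be a connected simple graph and let r ≥ 2 and h ≥ 0 be integers such that there exists an edge subset whose removal leaves at least r components each with at least h+1 vertices. If F is such an edge subset of minimum size (so |F| = λ^h_r(G)), then G−F has exactly r connected components. -/
open SimpleGraph

/-- If `H'` has at most the edge `s(u, v)` more than `H`, then two vertices reachable from each
other in `H'` are so in `H`, or are joined by a path through that edge. -/
lemma SimpleGraph.Reachable.of_adj_or_eq {V : Type*} {H H' : SimpleGraph V} {u v : V}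
    (hadj : ∀ a b, H'.Adj a b → H.Adj a b ∨ s(a, b) = s(u, v)) {a b : V}
    (hab : H'.Reachable a b) :
    H.Reachable a b ∨ (H.Reachable a u ∧ H.Reachable v b) ∨
      (H.Reachable a v ∧ H.Reachable u b) := by
  obtain ⟨p⟩ := hab
  induction p with
  | nil => exact .inl .rfl
  | cons hac _ ih =>
    rcases hadj _ _ hac with hac | hac
    · have hac := hac.reachable
      rcases ih with h | ⟨h₁, h₂⟩ | ⟨h₁, h₂⟩
      · exact .inl (hac.trans h)
      · exact .inr (.inl ⟨hac.trans h₁, h₂⟩)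
      · exact .inr (.inr ⟨hac.trans h₁, h₂⟩)
    · rcases Sym2.eq_iff.1 hac with ⟨rfl, rfl⟩ | ⟨rfl, rfl⟩
      · rcases ih with h | ⟨_, h⟩ | ⟨_, h⟩
        · exact .inr (.inl ⟨.rfl, h⟩)
        · exact .inr (.inl ⟨.rfl, h⟩)
        · exact .inl h
      · rcases ih with h | ⟨_, h⟩ | ⟨_, h⟩
        · exact .inr (.inr ⟨.rfl, h⟩)
        · exact .inl h
        · exact .inr (.inr ⟨.rfl, h⟩)

/-- Adding one edge lowers the number of connected components by at most one. -/
lemma SimpleGraph.card_connectedComponent_le_add_one {V : Type*} [Finite V]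
    {H H' : SimpleGraph V} {u v : V} (hle : H ≤ H')
    (hadj : ∀ a b, H'.Adj a b → H.Adj a b ∨ s(a, b) = s(u, v)) :
    Nat.card H.ConnectedComponent ≤ Nat.card H'.ConnectedComponent + 1 := by
  classical
  rw [← Finite.card_option]
  let f : H.ConnectedComponent → Option H'.ConnectedComponent := fun c =>
    if c = H.connectedComponentMk v then none else some (c.map (Hom.ofLE hle))
  refine Nat.card_le_card_of_injective f fun c d hcd => ?_
  by_cases hc : c = H.connectedComponentMk v <;> by_cases hd : d = H.connectedComponentMk v
  · rw [hc, hd]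
  · simp [f, hc, hd] at hcd
  · simp [f, hc, hd] at hcd
  · simp only [f, hc, hd, if_false, Option.some.injEq] at hcd
    induction c, d using ConnectedComponent.ind₂ with
    | _ a b =>
      have hab : H'.Reachable a b := ConnectedComponent.exact hcd
      rcases hab.of_adj_or_eq hadj with h | ⟨_, h⟩ | ⟨h, _⟩
      · exact ConnectedComponent.sound h
      · exact absurd (ConnectedComponent.sound h.symm) hd
      · exact absurd (ConnectedComponent.sound h) hc

/-- Restoring an edge of a good edge cut that leaves more than `r` components yields a good
edge cut. -/
lemma GoodEdgeCut.erase {V : Type*} [Finite V] [DecidableEq V] {G : SimpleGraph V} {r h : ℕ}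
    {F : Finset (Sym2 V)} (hF : GoodEdgeCut G r h F)
    (hlt : r < Nat.card (G.deleteEdges (F : Set (Sym2 V))).ConnectedComponent) (e : Sym2 V) :
    GoodEdgeCut G r h (F.erase e) := by
  obtain ⟨hsub, -, hsize⟩ := hF
  have hsubset : ((F.erase e : Finset (Sym2 V)) : Set (Sym2 V)) ⊆ F := by
    exact_mod_cast F.erase_subset e
  have hle : G.deleteEdges (F : Set (Sym2 V)) ≤
      G.deleteEdges ((F.erase e : Finset (Sym2 V)) : Set (Sym2 V)) :=
    deleteEdges_anti hsubset
  refine ⟨hsubset.trans hsub, ?_, fun c => ?_⟩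
  · induction e with
    | _ u v =>
      have := card_connectedComponent_le_add_one (u := u) (v := v) hle fun a b hab => by
        simp only [deleteEdges_adj, Finset.mem_coe, Finset.mem_erase] at hab ⊢
        tauto
      omega
  · induction c using ConnectedComponent.ind with
    | _ a =>
      refine (hsize (connectedComponentMk _ a)).trans ?_
      refine Nat.card_mono (Set.toFinite _) fun b hb => ?_
      exact ConnectedComponent.sound ((ConnectedComponent.exact hb).mono hle)

theorem card_connectedComponent_eq_of_min_goodEdgeCut {V : Type*} [Fintype V]
    (G : SimpleGraph V) (r h : ℕ) (hr : 2 ≤ r) (hconn : G.Connected)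
    (F : Finset (Sym2 V)) (hF : GoodEdgeCut G r h F)
    (hmin : ∀ F' : Finset (Sym2 V), GoodEdgeCut G r h F' → F.card ≤ F'.card) :
    Nat.card (G.deleteEdges (F : Set (Sym2 V))).ConnectedComponent = r := by
  classical
  by_contra hne
  have hlt := lt_of_le_of_ne hF.2.1 (Ne.symm hne)
  obtain ⟨e, he⟩ : F.Nonempty := by
    rw [Finset.nonempty_iff_ne_empty]
    rintro rfl
    have := hconn.preconnected.subsingleton_connectedComponent
    rw [Finset.coe_empty, deleteEdges_empty] at hlt
    have := Finite.card_le_one_iff_subsingleton.2 this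
    omega
  exact (hmin _ (hF.erase hlt e)).not_gt (Finset.card_erase_lt_of_mem he)
end

section
/- Let r ≥ 2, h ≥ 1, λ ≥ r−1 and 1 ≤ δ ≤ h be integers, and let G be a connected simple graph on n ≥ (λ+1)(h+1)² vertices with minimum degree δ. Suppose there is an edge subset F of G with |F| = λ such that G−F has exactly r components C_1, …, C_r with |V(C_1)| ≥ |V(C_2)| ≥ … ≥ |V(C_r)| ≥ h+1, and suppose |V(C_j)| ≥ h+2 for some 2 ≤ j ≤ r. Then ρ(G) < n − (r−1)(h+1) − 1. -/
open SimpleGraph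

namespace SimpleGraph

variable {V : Type*} [Fintype V]

lemma exists_eigenvector_spectralRadius [Nonempty V] [DecidableEq V] (G : SimpleGraph V)
    [DecidableRel G.Adj] :
    ∃ y : V → ℝ, y ≠ 0 ∧ ∀ v, ∑ u ∈ G.neighborFinset v, y u = G.spectralRadius * y v := by
  have key : ∃ y : V → ℝ, y ≠ 0 ∧
      (G.adjMatrix ℝ).mulVec y = (⨆ i, (adjMatrix_isHermitian G).eigenvalues i) • y := by
    obtain ⟨i, hi⟩ := exists_eq_ciSup_of_finite (f := (adjMatrix_isHermitian G).eigenvalues)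
    refine ⟨(adjMatrix_isHermitian G).eigenvectorBasis i, ?_, ?_⟩
    · intro h0
      refine (adjMatrix_isHermitian G).eigenvectorBasis.orthonormal.ne_zero i ?_
      ext v
      exact congrFun h0 v
    · rw [← hi]
      exact (adjMatrix_isHermitian G).mulVec_eigenvectorBasis i
  obtain ⟨y, hy, h⟩ := key
  have hs : G.spectralRadius = ⨆ i, (adjMatrix_isHermitian G).eigenvalues i := by
    unfold spectralRadius
    congr!
  refine ⟨y, hy, fun v => ?_⟩
  have := congrFun h v
  rw [adjMatrix_mulVec_apply] at this
  rw [this, hs]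
  rfl

/-- The square of the spectral radius is at most any upper bound on the row sums of the square
of the adjacency matrix. -/
lemma spectralRadius_sq_le [Nonempty V] [DecidableEq V] (G : SimpleGraph V) [DecidableRel G.Adj]
    (B : ℝ) (hB : ∀ v, ∑ u ∈ G.neighborFinset v, (G.degree u : ℝ) ≤ B) :
    G.spectralRadius ^ 2 ≤ B := by
  obtain ⟨y, hy, h⟩ := G.exists_eigenvector_spectralRadius
  obtain ⟨v, hv⟩ := Finite.exists_max fun v => |y v|
  have hpos : 0 < |y v| := by
    obtain ⟨w, hw⟩ := Function.ne_iff.mp hy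
    exact (abs_pos.mpr hw).trans_le (hv w)
  have hsq : G.spectralRadius ^ 2 * y v
      = ∑ u ∈ G.neighborFinset v, ∑ w ∈ G.neighborFinset u, y w := by
    simp_rw [h, ← Finset.mul_sum, h]
    ring
  refine le_of_mul_le_mul_right ?_ hpos
  calc G.spectralRadius ^ 2 * |y v| = |G.spectralRadius ^ 2 * y v| := by
        rw [abs_mul, abs_of_nonneg (sq_nonneg G.spectralRadius)]
    _ ≤ ∑ u ∈ G.neighborFinset v, ∑ w ∈ G.neighborFinset u, |y w| := by
        rw [hsq]
        exact (Finset.abs_sum_le_sum_abs _ _).trans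
          (Finset.sum_le_sum fun u _ => Finset.abs_sum_le_sum_abs _ _)
    _ ≤ ∑ u ∈ G.neighborFinset v, G.degree u * |y v| := by
        refine Finset.sum_le_sum fun u _ => ?_
        rw [← card_neighborFinset_eq_degree, ← nsmul_eq_mul]
        exact Finset.sum_le_card_nsmul _ _ _ fun w _ => hv w
    _ ≤ B * |y v| := by
        rw [← Finset.sum_mul]
        exact mul_le_mul_of_nonneg_right (hB v) hpos.le

/-- Hong's bound `ρ(G)² ≤ 2e - n + 1` for graphs without isolated vertices. -/
lemma spectralRadius_sq_le_of_one_le_degree [Nonempty V] [DecidableEq V] (G : SimpleGraph V)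
    [DecidableRel G.Adj] (hG : ∀ v, 1 ≤ G.degree v) :
    G.spectralRadius ^ 2 ≤ 2 * (G.edgeFinset.card : ℝ) - Fintype.card V + 1 := by
  refine G.spectralRadius_sq_le _ fun v => ?_
  have hsum : ∑ u, G.degree u = 2 * G.edgeFinset.card := G.sum_degrees_eq_twice_card_edges
  have hsplit := Finset.sum_add_sum_compl (insert v (G.neighborFinset v)) (fun u => G.degree u)
  have hv : v ∉ G.neighborFinset v := by simp
  rw [Finset.sum_insert hv] at hsplit
  have hcompl : (insert v (G.neighborFinset v))ᶜ.card
      ≤ ∑ u ∈ (insert v (G.neighborFinset v))ᶜ, G.degree u := by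
    simpa using Finset.card_nsmul_le_sum (insert v (G.neighborFinset v))ᶜ
      (fun u => G.degree u) 1 fun u _ => hG u
  have hcard := Finset.card_add_card_compl (insert v (G.neighborFinset v))
  rw [Finset.card_insert_of_notMem hv, card_neighborFinset_eq_degree] at hcard
  have : ∑ u ∈ G.neighborFinset v, G.degree u + Fintype.card V
      ≤ 2 * G.edgeFinset.card + 1 := by omega
  have : ((∑ u ∈ G.neighborFinset v, G.degree u : ℕ) : ℝ) + Fintype.card V
      ≤ 2 * G.edgeFinset.card + 1 := by exact_mod_cast this
  push_cast at this
  linarith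

lemma sum_comp_connectedComponentMk [DecidableEq V] (G : SimpleGraph V)
    [Fintype G.ConnectedComponent] (f : G.ConnectedComponent → ℕ) :
    ∑ v, f (G.connectedComponentMk v) = ∑ c, Nat.card c.supp * f c := by
  classical
  rw [← Finset.sum_fiberwise Finset.univ G.connectedComponentMk]
  refine Finset.sum_congr rfl fun c _ => ?_
  rw [Finset.sum_congr rfl (g := fun _ => f c) (by simp +contextual), Finset.sum_const,
    smul_eq_mul, Nat.card_eq_fintype_card, Fintype.card_subtype]
  simp only [ConnectedComponent.mem_supp_iff]

lemma sum_card_supp (G : SimpleGraph V) [Fintype G.ConnectedComponent] :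
    ∑ c : G.ConnectedComponent, Nat.card c.supp = Fintype.card V := by
  classical
  simpa using (G.sum_comp_connectedComponentMk fun _ => 1).symm

lemma degree_add_one_le_card_supp [DecidableEq V] (G : SimpleGraph V) [DecidableRel G.Adj]
    (v : V) : G.degree v + 1 ≤ Nat.card (G.connectedComponentMk v).supp := by
  classical
  have hv : v ∉ G.neighborFinset v := by simp
  rw [← card_neighborFinset_eq_degree, ← Finset.card_insert_of_notMem hv,
    Nat.card_coe_set_eq, ← Set.ncard_coe_finset]
  refine Set.ncard_le_ncard ?_ (Set.toFinite _)
  intro u hu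
  simp only [Finset.coe_insert, coe_neighborFinset, Set.mem_insert_iff, mem_neighborSet] at hu
  rw [ConnectedComponent.mem_supp_iff, ConnectedComponent.eq]
  rcases hu with rfl | hu
  · exact Reachable.rfl
  · exact hu.symm.reachable

lemma two_mul_card_edgeFinset_add_card_le [DecidableEq V] (G : SimpleGraph V)
    [DecidableRel G.Adj] [Fintype G.ConnectedComponent] :
    2 * G.edgeFinset.card + Fintype.card V
      ≤ ∑ c : G.ConnectedComponent, Nat.card c.supp ^ 2 := by
  rw [← G.sum_degrees_eq_twice_card_edges]
  simp_rw [sq]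
  rw [← G.sum_comp_connectedComponentMk fun c => Nat.card c.supp, ← Finset.card_univ,
    Finset.card_eq_sum_ones, ← Finset.sum_add_distrib]
  exact Finset.sum_le_sum fun v _ => G.degree_add_one_le_card_supp v

lemma card_edgeFinset_le_add_deleteEdges [DecidableEq V] (G : SimpleGraph V) [DecidableRel G.Adj]
    (F : Finset (Sym2 V)) [DecidableRel (G.deleteEdges (F : Set (Sym2 V))).Adj] :
    G.edgeFinset.card ≤ (G.deleteEdges (F : Set (Sym2 V))).edgeFinset.card + F.card := by
  refine (Finset.card_le_card fun e he => ?_).trans (Finset.card_union_le _ _)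
  by_cases heF : e ∈ F
  · exact Finset.mem_union_right _ heF
  · refine Finset.mem_union_left _ ?_
    simp only [mem_edgeFinset, edgeSet_deleteEdges] at he ⊢
    exact ⟨he, by simpa using heF⟩

end SimpleGraph

/-- If natural numbers `k i ≥ a` have two members exceeding `a`, then none of them reaches the
value it would have if all the others were equal to `a`. -/
lemma add_card_sub_one_mul_lt_sum {ι : Type*} [Fintype ι] (k : ι → ℕ) (a : ℕ)
    (hk : ∀ i, a ≤ k i) {i₁ i₂ : ι} (hne : i₁ ≠ i₂) (h₁ : a < k i₁) (h₂ : a < k i₂) (i : ι) :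
    k i + (Fintype.card ι - 1) * a < ∑ j, k j := by
  classical
  rw [← Finset.add_sum_erase _ _ (Finset.mem_univ i), ← Finset.card_univ,
    ← Finset.card_erase_of_mem (Finset.mem_univ i), ← smul_eq_mul, ← Finset.sum_const]
  refine Nat.add_lt_add_left (Finset.sum_lt_sum (fun j _ => hk j) ?_) _
  by_cases hi : i = i₁
  · exact ⟨i₂, by simp [hi, hne.symm], h₂⟩
  · exact ⟨i₁, by simp [Ne.symm hi], h₁⟩

/-- Chord bound for a sum of squares of numbers lying in `[a, b]`. -/
lemma sum_sq_le_of_mem_Icc {ι : Type*} [Fintype ι] (k : ι → ℝ) (a b : ℝ)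
    (ha : ∀ i, a ≤ k i) (hb : ∀ i, k i ≤ b) :
    ∑ i, k i ^ 2 ≤ (a + b) * ∑ i, k i - Fintype.card ι * (a * b) := by
  rw [Finset.mul_sum, ← nsmul_eq_mul, ← Finset.card_univ, ← Finset.sum_const,
    ← Finset.sum_sub_distrib]
  refine Finset.sum_le_sum fun i _ => ?_
  nlinarith [mul_nonneg (sub_nonneg.mpr (ha i)) (sub_nonneg.mpr (hb i))]

theorem spectralRadius_lt_of_two_big_components {V : Type*} [Fintype V] [DecidableEq V]
    (G : SimpleGraph V) [DecidableRel G.Adj] (n r h lam δ : ℕ)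
    (hr : 2 ≤ r) (hh : 1 ≤ h) (hlam : r - 1 ≤ lam) (hδ1 : 1 ≤ δ) (hδh : δ ≤ h)
    (hnbig : (lam + 1) * (h + 1) ^ 2 ≤ n) (hcard : Fintype.card V = n)
    (hconn : G.Connected) (hmin : G.minDegree = δ)
    (F : Finset (Sym2 V)) (hFsub : (F : Set (Sym2 V)) ⊆ G.edgeSet) (hFcard : F.card = lam)
    (hcomp : Nat.card (G.deleteEdges (F : Set (Sym2 V))).ConnectedComponent = r)
    (hsize : ∀ c : (G.deleteEdges (F : Set (Sym2 V))).ConnectedComponent,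
      h + 1 ≤ Nat.card c.supp)
    (hbig : ∃ c₁ c₂ : (G.deleteEdges (F : Set (Sym2 V))).ConnectedComponent,
      c₁ ≠ c₂ ∧ h + 2 ≤ Nat.card c₁.supp ∧ h + 2 ≤ Nat.card c₂.supp) :
    G.spectralRadius < (n : ℝ) - ((r : ℝ) - 1) * ((h : ℝ) + 1) - 1 := by
  classical
  set H := G.deleteEdges (F : Set (Sym2 V))
  have : Nonempty V := hconn.nonempty
  have : Fintype H.ConnectedComponent := Fintype.ofFinite _
  have hcomp' : Fintype.card H.ConnectedComponent = r := by
    rw [← Nat.card_eq_fintype_card, hcomp]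
  have hdeg : ∀ v, 1 ≤ G.degree v := fun v => by
    have := G.minDegree_le_degree v
    omega
  obtain ⟨c₁, c₂, hne, h₁, h₂⟩ := hbig
  have hsum := H.sum_card_supp
  have hub : ∀ c : H.ConnectedComponent, (Nat.card c.supp : ℝ)
      ≤ n - (r - 1) * (h + 1) - 1 := fun c => by
    have := add_card_sub_one_mul_lt_sum (fun c : H.ConnectedComponent => Nat.card c.supp) (h + 1)
      hsize hne h₁ h₂ c
    rw [hsum, hcard, hcomp'] at this
    have : ((Nat.card c.supp + (r - 1) * (h + 1) + 1 : ℕ) : ℝ) ≤ n := by exact_mod_cast this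
    push_cast [Nat.cast_sub (show 1 ≤ r by omega)] at this
    linarith
  have hsq := sum_sq_le_of_mem_Icc (fun c : H.ConnectedComponent => (Nat.card c.supp : ℝ))
    (h + 1) _ (fun c => by exact_mod_cast hsize c) hub
  have hsumR : ∑ c : H.ConnectedComponent, (Nat.card c.supp : ℝ) = n := by
    exact_mod_cast hsum.trans hcard
  have hedgeH : 2 * (H.edgeFinset.card : ℝ) + n
      ≤ ∑ c : H.ConnectedComponent, (Nat.card c.supp : ℝ) ^ 2 := by
    have := H.two_mul_card_edgeFinset_add_card_le
    rw [hcard] at this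
    exact_mod_cast this
  have hedge : (G.edgeFinset.card : ℝ) ≤ H.edgeFinset.card + lam := by
    have := G.card_edgeFinset_le_add_deleteEdges F
    rw [hFcard] at this
    exact_mod_cast this
  have hρ := G.spectralRadius_sq_le_of_one_le_degree hdeg
  rw [hcard] at hρ
  rw [hsumR, hcomp'] at hsq
  have hrlam : (r : ℝ) - 1 ≤ lam := by
    have : (r : ℝ) ≤ lam + 1 := by exact_mod_cast (by omega : r ≤ lam + 1)
    linarith
  have hhR : (1 : ℝ) ≤ h := by exact_mod_cast hh
  have hnR : ((lam : ℝ) + 1) * (h + 1) ^ 2 ≤ n := by exact_mod_cast hnbig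
  have hmul : ((r : ℝ) - 1) * (h + 1) ≤ lam * (h + 1) := by gcongr
  have hM : 0 < (n : ℝ) - (r - 1) * (h + 1) - 1 := by nlinarith
  refine lt_of_pow_lt_pow_left₀ 2 hM.le ?_
  nlinarith
end

section
/- Let r ≥ 2, h ≥ 1, λ ≥ r−1 and 1 ≤ δ ≤ h be integers, and let G be a connected simple graph on n ≥ (λ+1)(h+1)² vertices with minimum degree δ. Suppose there is an edge subset F of G with |F| = λ such that G−F has exactly r components C_1, …, C_r, where |V(C_1)| = n − (r−1)(h+1) and |V(C_i)| = h+1 for 2 ≤ i ≤ r, and suppose that some vertex of C_1 has degree δ in G. Then ρ(G) < n − (r−1)(h+1) − 1. -/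
open SimpleGraph

/-- A Collatz–Wielandt bound: a positive vector which the adjacency matrix strictly contracts
below the factor `μ` shows that every eigenvalue is less than `μ`. -/
lemma adjMatrix_eigenvalues_lt_of_pos_vector {V : Type*} [Fintype V] [DecidableEq V]
    (G : SimpleGraph V) [DecidableRel G.Adj] (y : V → ℝ) (μ : ℝ) (hy : ∀ i, 0 < y i)
    (hlt : ∀ i, ∑ j, (if G.Adj i j then y j else 0) < μ * y i) (i : V) :
    (adjMatrix_isHermitian G).eigenvalues i < μ := by
  set z : V → ℝ := ⇑((adjMatrix_isHermitian G).eigenvectorBasis i)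
  set θ := (adjMatrix_isHermitian G).eigenvalues i
  have hev : (G.adjMatrix ℝ).mulVec z = θ • z :=
    (adjMatrix_isHermitian G).mulVec_eigenvectorBasis i
  have hz0 : ∃ k, z k ≠ 0 := by
    by_contra! h0
    have h1 := (adjMatrix_isHermitian G).eigenvectorBasis.orthonormal.ne_zero i
    exact h1 (by ext k; exact h0 k)
  obtain ⟨k, hk⟩ := hz0
  have : Nonempty V := ⟨k⟩
  obtain ⟨m, hm⟩ := Finite.exists_max fun j => |z j| / y j
  have hmpos : 0 < |z m| / y m := (div_pos (abs_pos.mpr hk) (hy k)).trans_le (hm k)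
  have hzm : |z m| = |z m| / y m * y m := (div_mul_cancel₀ _ (hy m).ne').symm
  have hrow : θ * z m = ∑ j, if G.Adj m j then z j else 0 := by
    have h1 := congrFun hev m
    simp only [Matrix.mulVec, dotProduct, SimpleGraph.adjMatrix_apply, Pi.smul_apply,
      smul_eq_mul, ite_mul, one_mul, zero_mul] at h1
    exact h1.symm
  have hbound : |θ * z m| ≤ |z m| / y m * ∑ j, (if G.Adj m j then y j else 0) := by
    rw [hrow, Finset.mul_sum]
    refine (Finset.abs_sum_le_sum_abs _ _).trans (Finset.sum_le_sum fun j _ => ?_)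
    split_ifs with hadj
    · exact (div_le_iff₀ (hy j)).mp (hm j)
    · simp
  have hlt' : |θ| * |z m| < μ * |z m| := by
    calc |θ| * |z m| = |θ * z m| := (abs_mul _ _).symm
      _ ≤ _ := hbound
      _ < |z m| / y m * (μ * y m) := mul_lt_mul_of_pos_left (hlt m) hmpos
      _ = μ * (|z m| / y m * y m) := by ring
      _ = μ * |z m| := by rw [← hzm]
  exact (le_abs_self θ).trans_lt (lt_of_mul_lt_mul_right hlt' (abs_nonneg _))

lemma SimpleGraph.spectralRadius_lt_of_pos_vector {V : Type*} [Fintype V] [Nonempty V]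
    (G : SimpleGraph V) [DecidableRel G.Adj] (y : V → ℝ) (μ : ℝ) (hy : ∀ i, 0 < y i)
    (hlt : ∀ i, ∑ j, (if G.Adj i j then y j else 0) < μ * y i) :
    G.spectralRadius < μ := by
  classical
  have iSup_lt : ∀ f : V → ℝ, (∀ i, f i < μ) → ⨆ i, f i < μ := by
    intro f hf
    obtain ⟨i, hi⟩ := exists_eq_ciSup_of_finite (f := f)
    exact hi ▸ hf i
  exact iSup_lt _ (@adjMatrix_eigenvalues_lt_of_pos_vector V (Fintype.ofFinite V)
    (Classical.decEq V) G (Classical.decRel G.Adj) y μ hy (by convert hlt))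

theorem spectralRadius_lt_of_minDegree_vertex_in_big_component {V : Type*} [Fintype V]
    [DecidableEq V] (G : SimpleGraph V) [DecidableRel G.Adj] (n r h lam δ : ℕ)
    (hr : 2 ≤ r) (hh : 1 ≤ h) (hlam : r - 1 ≤ lam) (hδ1 : 1 ≤ δ) (hδh : δ ≤ h)
    (hnbig : (lam + 1) * (h + 1) ^ 2 ≤ n) (hcard : Fintype.card V = n)
    (hconn : G.Connected) (hmin : G.minDegree = δ)
    (F : Finset (Sym2 V)) (hFsub : (F : Set (Sym2 V)) ⊆ G.edgeSet) (hFcard : F.card = lam)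
    (hcomp : Nat.card (G.deleteEdges (F : Set (Sym2 V))).ConnectedComponent = r)
    (hbig : ∃ c₀ : (G.deleteEdges (F : Set (Sym2 V))).ConnectedComponent,
      Nat.card c₀.supp = n - (r - 1) * (h + 1) ∧
      (∀ c : (G.deleteEdges (F : Set (Sym2 V))).ConnectedComponent, c ≠ c₀ →
        Nat.card c.supp = h + 1) ∧
      ∃ v ∈ c₀.supp, G.degree v = δ) :
    G.spectralRadius < (n : ℝ) - ((r : ℝ) - 1) * ((h : ℝ) + 1) - 1 := by
  classical
  obtain ⟨H, hH⟩ : ∃ H, H = G.deleteEdges (F : Set (Sym2 V)) := ⟨_, rfl⟩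
  obtain ⟨K, hK⟩ : ∃ K, K = SimpleGraph.fromEdgeSet (F : Set (Sym2 V)) := ⟨_, rfl⟩
  rw [← hH] at hcomp hbig
  obtain ⟨c₀, hc₀, hc, v, hv, hdv⟩ := hbig
  have hadj : ∀ a b, G.Adj a b → H.Adj a b ∨ K.Adj a b := by
    intro a b hab
    by_cases hF : s(a, b) ∈ F
    · exact Or.inr (by simp [hK, hF, hab.ne])
    · exact Or.inl (by simp [hH, SimpleGraph.deleteEdges_adj, hF, hab])
  have hKedge : K.edgeFinset = F := by
    ext e
    simp only [SimpleGraph.mem_edgeFinset, hK, SimpleGraph.edgeSet_fromEdgeSet, Set.mem_sdiff,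
      Finset.mem_coe]
    exact ⟨fun he => he.1, fun he => ⟨he, G.not_isDiag_of_mem_edgeSet (hFsub he)⟩⟩
  have hKsum : ∑ w, K.degree w = 2 * lam := by
    rw [K.sum_degrees_eq_twice_card_edges, hKedge, hFcard]
  have hKle : ∀ w, K.degree w ≤ lam := by
    intro w
    rw [← K.card_incidenceFinset_eq_degree, ← hFcard, ← hKedge]
    exact Finset.card_le_card (K.incidenceFinset_subset w)
  have hcross : ∀ a b, G.Adj a b →
      H.connectedComponentMk a ≠ H.connectedComponentMk b → K.Adj a b := by
    intro a b hab hne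
    exact (hadj a b hab).resolve_left fun h1 =>
      hne (SimpleGraph.ConnectedComponent.sound h1.reachable)
  have hsupp : ∀ c : H.ConnectedComponent,
      (Finset.univ.filter fun w => H.connectedComponentMk w = c).card = Nat.card c.supp := by
    intro c
    rw [Nat.card_eq_fintype_card, Fintype.card_subtype]
    simp only [SimpleGraph.ConnectedComponent.mem_supp_iff]
  set S := Finset.univ.filter fun w => H.connectedComponentMk w = c₀ with hS
  have hmemS : ∀ w, w ∈ S ↔ H.connectedComponentMk w = c₀ := by simp [hS]
  have hvS : v ∈ S := (hmemS v).mpr hv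
  obtain ⟨q, rfl⟩ : ∃ q, r = q + 1 := ⟨r - 1, by omega⟩
  rw [Nat.add_sub_cancel] at hlam hc₀
  have hqh : q * (h + 1) ≤ lam * (h + 1) := Nat.mul_le_mul_right _ hlam
  obtain ⟨M, hM⟩ : ∃ M, n = q * (h + 1) + (M + 1) := by
    refine ⟨n - q * (h + 1) - 1, ?_⟩
    have : lam * (h + 1) < (lam + 1) * (h + 1) ^ 2 := by nlinarith [Nat.zero_le (lam * h)]
    omega
  have hMbig : lam * (h * (h + 1)) + h * (h + 2) ≤ M := by nlinarith
  have hScard : S.card = M + 1 := by rw [hS, hsupp, hc₀]; omega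
  have hlamh : lam ≤ lam * h := Nat.le_mul_of_pos_right _ hh
  have hlamhh : lam * (h + 1) ≤ lam * (h * (h + 1)) :=
    Nat.mul_le_mul_left _ (Nat.le_mul_of_pos_left _ hh)
  have hM1 : lam + h + 1 ≤ M := by nlinarith
  have hM2 : lam * (h + 1) + h + 1 < M := by nlinarith
  have hgoal : (n : ℝ) - (((q + 1 : ℕ) : ℝ) - 1) * ((h : ℝ) + 1) - 1 = (M : ℝ) := by
    rw [hM]; push_cast; ring
  rw [hgoal]
  set y : V → ℕ := fun j => if j = v then h + 1 else if j ∈ S then M else K.degree j + h with hy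
  have hyM : ∀ j, y j ≤ M := by
    intro j
    have := hKle j
    simp only [hy]
    split_ifs <;> omega
  have hysmall : ∀ j, j ∉ S → y j = K.degree j + h := by
    intro j hj
    have hjv : j ≠ v := fun e => hj (e ▸ hvS)
    simp [hy, hj, hjv]
  have hypos : ∀ j, 0 < y j := by
    intro j
    simp only [hy]
    split_ifs <;> omega
  have hrow : ∀ i, ∑ j ∈ G.neighborFinset i, y j < M * y i := by
    intro i
    by_cases hiv : i = v
    · subst hiv
      calc ∑ j ∈ G.neighborFinset i, y j ≤ (G.neighborFinset i).card • M :=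
            Finset.sum_le_card_nsmul _ _ _ fun j _ => hyM j
        _ = δ * M := by rw [G.card_neighborFinset_eq_degree, hdv, smul_eq_mul]
        _ < M * (h + 1) := by nlinarith
        _ = M * y i := by simp [hy]
    by_cases hiS : i ∈ S
    · have hyi : y i = M := by simp [hy, hiv, hiS]
      have hsub : G.neighborFinset i ⊆ S.erase i ∪ (K.neighborFinset i).filter (· ∉ S) := by
        intro j hj
        rw [SimpleGraph.mem_neighborFinset] at hj
        by_cases hjS : j ∈ S
        · exact Finset.mem_union_left _ (Finset.mem_erase.mpr ⟨hj.ne', hjS⟩)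
        · refine Finset.mem_union_right _ (Finset.mem_filter.mpr ⟨?_, hjS⟩)
          rw [SimpleGraph.mem_neighborFinset]
          refine hcross i j hj fun e => hjS ?_
          rw [hmemS] at hiS ⊢
          exact e ▸ hiS
      have hvSi : v ∈ S.erase i := Finset.mem_erase.mpr ⟨fun e => hiv e.symm, hvS⟩
      have h1 : ∑ j ∈ S.erase i, y j ≤ (M - 1) * M + (h + 1) := by
        rw [← Finset.sum_erase_add _ _ hvSi]
        refine add_le_add ?_ (by simp [hy])
        refine (Finset.sum_le_card_nsmul _ _ M fun j _ => hyM j).trans_eq ?_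
        rw [Finset.card_erase_of_mem hvSi, Finset.card_erase_of_mem hiS, hScard, smul_eq_mul]
        simp
      set T := (K.neighborFinset i).filter (· ∉ S) with hT
      have hTcard : T.card ≤ K.degree i := by
        rw [← K.card_neighborFinset_eq_degree]
        exact Finset.card_filter_le _ _
      have hiT : i ∉ T := by simp [hT]
      have hTdeg : K.degree i + ∑ j ∈ T, K.degree j ≤ 2 * lam := by
        rw [← hKsum, ← Finset.sum_insert (f := fun w => K.degree w) hiT]
        exact Finset.sum_le_sum_of_subset (Finset.subset_univ _)
      have h2 : ∑ j ∈ T, y j = ∑ j ∈ T, K.degree j + T.card * h := by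
        rw [Finset.sum_congr rfl fun j hj => hysmall j (Finset.mem_filter.mp hj).2,
          Finset.sum_add_distrib, Finset.sum_const, smul_eq_mul]
      have h3 : ∑ j ∈ G.neighborFinset i, y j ≤ ∑ j ∈ S.erase i, y j + ∑ j ∈ T, y j := by
        refine (Finset.sum_le_sum_of_subset hsub).trans ?_
        rw [← Finset.sum_union_inter]
        exact Nat.le_add_right _ _
      have h4 : T.card * h ≤ K.degree i * h := Nat.mul_le_mul_right _ hTcard
      have h5 : K.degree i * h + lam ≤ K.degree i + lam * h := by
        obtain ⟨p, rfl⟩ : ∃ p, h = p + 1 := ⟨h - 1, by omega⟩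
        have h6 := Nat.mul_le_mul_right p (hKle i)
        linarith
      obtain ⟨m, rfl⟩ : ∃ m, M = m + 1 := ⟨M - 1, by omega⟩
      rw [Nat.add_sub_cancel] at h1
      have h6 : h + 1 + (∑ j ∈ T, K.degree j + T.card * h) < m + 1 := by linarith
      rw [hyi]
      linarith
    · rw [hysmall i hiS]
      set c := H.connectedComponentMk i with hci
      have hcc : c ≠ c₀ := fun e => hiS ((hmemS i).mpr e)
      set C := Finset.univ.filter fun w => H.connectedComponentMk w = c with hC
      have hCcard : C.card = h + 1 := (hsupp c).trans (hc c hcc)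
      have hiC : i ∈ C := by simp [hC, hci]
      have hsub : G.neighborFinset i ⊆ C.erase i ∪ K.neighborFinset i := by
        intro j hj
        rw [SimpleGraph.mem_neighborFinset] at hj
        by_cases hjC : j ∈ C
        · exact Finset.mem_union_left _ (Finset.mem_erase.mpr ⟨hj.ne', hjC⟩)
        · refine Finset.mem_union_right _ ?_
          rw [SimpleGraph.mem_neighborFinset]
          refine hcross i j hj fun e => hjC ?_
          simp [hC, hci, e]
      have h3 : ∑ j ∈ G.neighborFinset i, y j
          ≤ ∑ j ∈ C.erase i, y j + ∑ j ∈ K.neighborFinset i, y j := by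
        refine (Finset.sum_le_sum_of_subset hsub).trans ?_
        rw [← Finset.sum_union_inter]
        exact Nat.le_add_right _ _
      have h1 : ∑ j ∈ C.erase i, y j ≤ h * (M - 1) := by
        refine (Finset.sum_le_card_nsmul _ _ (M - 1) fun j hj => ?_).trans_eq ?_
        · have hjS : j ∉ S := by
            rw [hmemS, (Finset.mem_filter.mp (Finset.mem_of_mem_erase hj)).2]
            exact hcc
          rw [hysmall j hjS]
          have := hKle j
          omega
        · rw [Finset.card_erase_of_mem hiC, hCcard, smul_eq_mul, Nat.add_sub_cancel]
      have h2 : ∑ j ∈ K.neighborFinset i, y j ≤ K.degree i * M := by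
        refine (Finset.sum_le_card_nsmul _ _ M fun j _ => hyM j).trans_eq ?_
        rw [K.card_neighborFinset_eq_degree, smul_eq_mul]
      obtain ⟨m, rfl⟩ : ∃ m, M = m + 1 := ⟨M - 1, by omega⟩
      rw [Nat.add_sub_cancel] at h1
      linarith
  have : Nonempty V := ⟨v⟩
  refine G.spectralRadius_lt_of_pos_vector (fun j => (y j : ℝ)) M
    (fun i => by exact_mod_cast hypos i) fun i => ?_
  rw [← Finset.sum_filter, ← G.neighborFinset_eq_filter]
  exact_mod_cast hrow i
end
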